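/- If an odd form ring (R, Δ) acts on an odd form ring (S, Θ), then the semi-direct product (S ⋊ R, Θ ⋊ Δ), with operations (b,a)+(b',a') = (b+b', a+a'), (b,a)(b',a') = (bb'+ab'+ba', aa'), conj(b,a) = (b̄, ā), φ(b,a) = (φ(b), φ(a)), π(v,u) = (π(v), π(u)), ρ(v,u) = (ρ(v) − conj(π(v))π(u), ρ(u)), and (v,u)·(b,a) = (v·b + v·a + u·b + φ(ā ρ(v) b + ā ρ(u) b), u·a), is an odd form ring, and (S, Θ) → (S ⋊ R, Θ ⋊ Δ) → (R, Δ) is a short exact sequence of odd form rings. -/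

import Mathlib

/-- The predicate expressing that a tuple of operations
`(add, mul, neg, 0, conj)` on `R` and `(∔, inverse, 0̇, ·, φ, π, ρ)` on `Δ`
constitutes an odd form ring `(R, Δ)`. -/
structure IsOddFormRing {R Δ : Type*}
    (addR : R → R → R) (mulR : R → R → R) (negR : R → R) (zeroR : R) (conjR : R → R)
    (mulD : Δ → Δ → Δ) (invD : Δ → Δ) (oneD : Δ)
    (actD : Δ → R → Δ) (phD : R → Δ) (piD rhoD : Δ → R) : Prop where
  add_assoc : ∀ a b c, addR (addR a b) c = addR a (addR b c)
  add_comm : ∀ a b, addR a b = addR b a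
  add_zero : ∀ a, addR a zeroR = a
  add_neg : ∀ a, addR a (negR a) = zeroR
  mul_assoc : ∀ a b c, mulR (mulR a b) c = mulR a (mulR b c)
  left_distrib : ∀ a b c, mulR a (addR b c) = addR (mulR a b) (mulR a c)
  right_distrib : ∀ a b c, mulR (addR a b) c = addR (mulR a c) (mulR b c)
  conj_add : ∀ a b, conjR (addR a b) = addR (conjR a) (conjR b)
  conj_mul : ∀ a b, conjR (mulR a b) = mulR (conjR b) (conjR a)
  conj_conj : ∀ a, conjR (conjR a) = a
  dmul_assoc : ∀ u v w, mulD (mulD u v) w = mulD u (mulD v w)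
  dmul_one : ∀ u, mulD u oneD = u
  one_dmul : ∀ u, mulD oneD u = u
  dmul_inv : ∀ u, mulD u (invD u) = oneD
  inv_dmul : ∀ u, mulD (invD u) u = oneD
  act_dmul : ∀ u v a, actD (mulD u v) a = mulD (actD u a) (actD v a)
  act_act : ∀ u a b, actD (actD u a) b = actD u (mulR a b)
  pi_dmul : ∀ u v, piD (mulD u v) = addR (piD u) (piD v)
  pi_act : ∀ u a, piD (actD u a) = mulR (piD u) a
  ph_add : ∀ a b, phD (addR a b) = mulD (phD a) (phD b)
  ph_act : ∀ a b, actD (phD b) a = phD (mulR (mulR (conjR a) b) a)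
  rho_dmul : ∀ u v, rhoD (mulD u v) =
    addR (addR (rhoD u) (negR (mulR (conjR (piD u)) (piD v)))) (rhoD v)
  rho_act : ∀ u a, rhoD (actD u a) = mulR (mulR (conjR a) (rhoD u)) a
  rho_conj : ∀ u, addR (addR (rhoD u) (conjR (rhoD u))) (mulR (conjR (piD u)) (piD u)) = zeroR
  pi_ph : ∀ a, piD (phD a) = zeroR
  rho_ph : ∀ a, rhoD (phD a) = addR a (negR (conjR a))
  comm_ph : ∀ u v, mulD (mulD (mulD u v) (invD u)) (invD v) =
    phD (negR (mulR (conjR (piD u)) (piD v)))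
  ph_symm : ∀ a, conjR a = a → phD a = oneD
  act_add : ∀ u a b, actD u (addR a b) =
    mulD (mulD (actD u a) (phD (mulR (mulR (conjR b) (rhoD u)) a))) (actD u b)

/-- An action of an odd form ring `(R, Δ)` on an odd form ring `(S, Θ)`:
multiplication maps `R × S → S`, `S × R → S`, `Θ × R → Θ`, `Δ × S → Θ`
satisfying the compatibility axioms. -/
structure IsOddFormAction {R Δ S Θ : Type*}
    (addR : R → R → R) (mulR : R → R → R) (negR : R → R) (zeroR : R) (conjR : R → R)
    (mulD : Δ → Δ → Δ) (invD : Δ → Δ) (oneD : Δ)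
    (actD : Δ → R → Δ) (phD : R → Δ) (piD rhoD : Δ → R)
    (addS : S → S → S) (mulS : S → S → S) (negS : S → S) (zeroS : S) (conjS : S → S)
    (mulT : Θ → Θ → Θ) (invT : Θ → Θ) (oneT : Θ)
    (actT : Θ → S → Θ) (phT : S → Θ) (piT rhoT : Θ → S)
    (ars : R → S → S) (asr : S → R → S) (atr : Θ → R → Θ) (ads : Δ → S → Θ) : Prop where
  rs_conj : ∀ a b, ars a b = conjS (asr (conjS b) (conjR a))
  add_rs : ∀ a a' b, ars (addR a a') b = addS (ars a b) (ars a' b)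
  rs_add : ∀ a b b', ars a (addS b b') = addS (ars a b) (ars a b')
  add_sr : ∀ b b' a, asr (addS b b') a = addS (asr b a) (asr b' a)
  sr_add : ∀ b a a', asr b (addR a a') = addS (asr b a) (asr b a')
  mulR_rs : ∀ a a' b, ars (mulR a a') b = ars a (ars a' b)
  rs_mulS : ∀ a b b', mulS (ars a b) b' = ars a (mulS b b')
  rs_sr : ∀ a b a', asr (ars a b) a' = ars a (asr b a')
  sr_mulS : ∀ b a b', mulS (asr b a) b' = mulS b (ars a b')
  mulS_sr : ∀ b b' a, asr (mulS b b') a = mulS b (asr b' a)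
  sr_mulR : ∀ b a a', asr (asr b a) a' = asr b (mulR a a')
  ds_dmul : ∀ u u' b, ads (mulD u u') b = mulT (ads u b) (ads u' b)
  ds_add : ∀ u b b', ads u (addS b b') =
    mulT (mulT (ads u b) (phT (mulS (asr (conjS b') (rhoD u)) b))) (ads u b')
  tr_dmul : ∀ v v' a, atr (mulT v v') a = mulT (atr v a) (atr v' a)
  tr_add : ∀ v a a', atr v (addR a a') =
    mulT (mulT (atr v a) (phT (asr (ars (conjR a') (rhoT v)) a))) (atr v a')
  ds_actD : ∀ u a b, ads (actD u a) b = ads u (ars a b)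
  tr_ads : ∀ u b a, atr (ads u b) a = ads u (asr b a)
  actT_ads : ∀ u b b', actT (ads u b) b' = ads u (mulS b b')
  actT_atr : ∀ v a b, actT (atr v a) b = actT v (ars a b)
  tr_actT : ∀ v b a, atr (actT v b) a = actT v (asr b a)
  atr_atr : ∀ v a a', atr (atr v a) a' = atr v (mulR a a')
  ph_ds : ∀ a b, ads (phD a) b = phT (mulS (asr (conjS b) a) b)
  ph_tr : ∀ b a, atr (phT b) a = phT (asr (ars (conjR a) b) a)
  pi_ds : ∀ u b, piT (ads u b) = ars (piD u) b
  pi_tr : ∀ v a, piT (atr v a) = asr (piT v) a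
  rho_ds : ∀ u b, rhoT (ads u b) = mulS (asr (conjS b) (rhoD u)) b
  rho_tr : ∀ v a, rhoT (atr v a) = asr (ars (conjR a) (rhoT v)) a


section SemidirectProduct

variable {R Δ S Θ : Type*}

/-- Addition on `S ⋊ R`. -/
def sdAdd (addS : S → S → S) (addR : R → R → R) (p q : S × R) : S × R :=
  (addS p.1 q.1, addR p.2 q.2)

/-- Multiplication on `S ⋊ R`: `(b,a)(b',a') = (bb' + ab' + ba', aa')`. -/
def sdMul (addS : S → S → S) (mulS : S → S → S) (mulR : R → R → R)
    (ars : R → S → S) (asr : S → R → S) (p q : S × R) : S × R :=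
  (addS (addS (mulS p.1 q.1) (ars p.2 q.1)) (asr p.1 q.2), mulR p.2 q.2)

/-- Negation on `S ⋊ R`. -/
def sdNeg (negS : S → S) (negR : R → R) (p : S × R) : S × R := (negS p.1, negR p.2)

/-- Involution on `S ⋊ R`. -/
def sdConj (conjS : S → S) (conjR : R → R) (p : S × R) : S × R :=
  (conjS p.1, conjR p.2)

/-- The group operation on `Θ ⋊ Δ` (the central twist `φ(−conj(π u) π v')`
accounts for commuting `Δ` past `Θ`). -/
def sdDMul (mulT : Θ → Θ → Θ) (phT : S → Θ) (negS : S → S) (ars : R → S → S)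
    (conjR : R → R) (piD : Δ → R) (piT : Θ → S) (mulD : Δ → Δ → Δ)
    (x y : Θ × Δ) : Θ × Δ :=
  (mulT (mulT x.1 (phT (negS (ars (conjR (piD x.2)) (piT y.1))))) y.1, mulD x.2 y.2)

/-- Inversion on `Θ ⋊ Δ`. -/
def sdDInv (mulT : Θ → Θ → Θ) (invT : Θ → Θ) (phT : S → Θ) (ars : R → S → S)
    (conjR : R → R) (piD : Δ → R) (piT : Θ → S) (invD : Δ → Δ)
    (x : Θ × Δ) : Θ × Δ :=
  (mulT (invT (phT (ars (conjR (piD x.2)) (piT x.1)))) (invT x.1), invD x.2)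

/-- The `(S ⋊ R)^•`-action on `Θ ⋊ Δ`:
`(v,u)·(b,a) = (v·b + v·a + u·b + φ(ā ρ(v) b + ā ρ(u) b), u·a)`. -/
def sdAct (mulT : Θ → Θ → Θ) (actT : Θ → S → Θ) (atr : Θ → R → Θ)
    (ads : Δ → S → Θ) (phT : S → Θ) (addS : S → S → S) (mulS : S → S → S)
    (ars : R → S → S) (conjR : R → R) (rhoT : Θ → S) (mulR : R → R → R)
    (rhoD : Δ → R) (actD : Δ → R → Δ) (x : Θ × Δ) (p : S × R) : Θ × Δ :=
  (mulT (mulT (mulT (actT x.1 p.1) (atr x.1 p.2)) (ads x.2 p.1))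
    (phT (addS (mulS (ars (conjR p.2) (rhoT x.1)) p.1)
      (ars (mulR (conjR p.2) (rhoD x.2)) p.1))),
    actD x.2 p.2)

/-- `φ` on `S ⋊ R`. -/
def sdPh (phT : S → Θ) (phD : R → Δ) (p : S × R) : Θ × Δ := (phT p.1, phD p.2)

/-- `π` on `Θ ⋊ Δ`. -/
def sdPi (piT : Θ → S) (piD : Δ → R) (x : Θ × Δ) : S × R := (piT x.1, piD x.2)

/-- `ρ` on `Θ ⋊ Δ`: `ρ(v,u) = (ρ(v) − conj(π(v)) π(u), ρ(u))`. -/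
def sdRho (addS : S → S → S) (rhoT : Θ → S) (negS : S → S) (asr : S → R → S)
    (conjS : S → S) (piT : Θ → S) (piD : Δ → R) (rhoD : Δ → R)
    (x : Θ × Δ) : S × R :=
  (addS (rhoT x.1) (negS (asr (conjS (piT x.1)) (piD x.2))), rhoD x.2)

end SemidirectProduct

namespace IsOddFormRing

section Bundling

variable {R Δ : Type*} {addR mulR : R → R → R} {negR : R → R} {zeroR : R} {conjR : R → R}
  {mulD : Δ → Δ → Δ} {invD : Δ → Δ} {oneD : Δ} {actD : Δ → R → Δ} {phD : R → Δ} {piD rhoD : Δ → R}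

/-- The ring underlying an odd form ring. -/
abbrev toNonUnitalRing
    (h : IsOddFormRing addR mulR negR zeroR conjR mulD invD oneD actD phD piD rhoD) :
    NonUnitalRing R :=
  letI : Add R := ⟨addR⟩
  letI : Mul R := ⟨mulR⟩
  letI : Neg R := ⟨negR⟩
  letI : Zero R := ⟨zeroR⟩
  have zero_add (a : R) : 0 + a = a := (h.add_comm _ _).trans (h.add_zero a)
  letI : AddCommGroup R :=
    { add_assoc := h.add_assoc
      zero_add := zero_add
      add_zero := h.add_zero
      nsmul := nsmulRec
      zsmul := zsmulRec
      neg_add_cancel := fun a => (h.add_comm _ _).trans (h.add_neg a)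
      add_comm := h.add_comm }
  { mul_assoc := h.mul_assoc
    left_distrib := h.left_distrib
    right_distrib := h.right_distrib
    zero_mul := fun a => left_eq_add.mp 
      ((congrArg (mulR · a) (zero_add 0).symm).trans (h.right_distrib 0 0 a))
    mul_zero := fun a => left_eq_add.mp 
      ((congrArg (mulR a) (zero_add 0).symm).trans (h.left_distrib a 0 0)) }

/-- The group underlying an odd form ring. -/
abbrev toGroup
    (h : IsOddFormRing addR mulR negR zeroR conjR mulD invD oneD actD phD piD rhoD) : Group Δ :=
  letI : Mul Δ := ⟨mulD⟩
  letI : One Δ := ⟨oneD⟩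
  letI : Inv Δ := ⟨invD⟩
  Group.ofLeftAxioms h.dmul_assoc h.one_dmul h.inv_dmul

end Bundling

variable {R Δ : Type*} [NonUnitalRing R] [Group Δ] {conjR : R → R} {actD : Δ → R → Δ}
  {phD : R → Δ} {piD rhoD : Δ → R}
  (h : IsOddFormRing (· + · : R → R → R) (· * ·) (- ·) 0 conjR (· * ·) (·⁻¹) 1 actD phD piD rhoD)

include h

theorem conj_zero : conjR 0 = 0 := by
  simpa using h.conj_add 0 0

theorem conj_neg (a : R) : conjR (-a) = -conjR a := by
  rw [eq_neg_iff_add_eq_zero, ← h.conj_add, neg_add_cancel, h.conj_zero]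

theorem ph_zero : phD 0 = 1 := by
  simpa using h.ph_add 0 0

theorem ph_neg (a : R) : phD (-a) = (phD a)⁻¹ := by
  rw [eq_inv_iff_mul_eq_one, ← h.ph_add, neg_add_cancel, h.ph_zero]

theorem ph_conj (a : R) : phD (conjR a) = phD (-a) := by
  rw [h.ph_neg, eq_inv_iff_mul_eq_one, ← h.ph_add]
  apply h.ph_symm
  rw [h.conj_add, h.conj_conj, _root_.add_comm]

theorem ph_eq_of_sub_eq {a b : R} (c : R) (hc : a - b = c + conjR c) : phD a = phD b := by
  rw [eq_add_of_sub_eq hc, h.ph_add, h.ph_add, h.ph_conj, h.ph_neg, mul_inv_cancel, one_mul]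

theorem mul_eq_mul_ph (u v : Δ) : u * v = v * (u * phD (-(conjR (piD u) * piD v))) := by
  have central (a : R) (w : Δ) : phD a * w = w * phD a := by
    have := h.comm_ph (phD a) w
    simp only [h.pi_ph, h.conj_zero, zero_mul, neg_zero, h.ph_zero] at this
    rwa [mul_inv_eq_one, mul_inv_eq_iff_eq_mul] at this
  rw [← _root_.mul_assoc, ← central, ← h.comm_ph]
  group

theorem mul_mul_eq_mul_mul_ph (u v w : Δ) :
    u * (v * w) = v * (u * (phD (-(conjR (piD u) * piD v)) * w)) := by
  rw [← _root_.mul_assoc, h.mul_eq_mul_ph u v]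
  simp only [_root_.mul_assoc]

theorem ph_mul (a : R) (w : Δ) : phD a * w = w * phD a := by
  simpa [h.pi_ph, h.conj_zero, h.ph_zero] using h.mul_eq_mul_ph (phD a) w

theorem ph_mul_mul (a : R) (v w : Δ) : phD a * (v * w) = v * (phD a * w) := by
  rw [← _root_.mul_assoc, h.ph_mul, _root_.mul_assoc]

theorem ph_mul_ph (a b : R) : phD a * phD b = phD (a + b) := (h.ph_add a b).symm

theorem ph_mul_ph_mul (a b : R) (w : Δ) : phD a * (phD b * w) = phD (a + b) * w := by
  rw [h.ph_add, _root_.mul_assoc]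

theorem pi_one : piD 1 = 0 := by
  simpa using h.pi_dmul 1 1

theorem pi_inv (u : Δ) : piD u⁻¹ = -piD u := by
  rw [eq_neg_iff_add_eq_zero, ← h.pi_dmul, inv_mul_cancel, h.pi_one]

theorem rho_one : rhoD 1 = 0 := by
  simpa [h.pi_one] using h.rho_dmul 1 1

theorem conj_rho (u : Δ) : conjR (rhoD u) = -rhoD u - conjR (piD u) * piD u := by
  have := h.rho_conj u
  rw [_root_.add_assoc, add_eq_zero_iff_neg_eq] at this
  rw [this, add_sub_cancel_right]

theorem act_zero (u : Δ) : actD u 0 = 1 := by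
  simpa [h.ph_zero] using h.act_add u 0 0

end IsOddFormRing

namespace IsOddFormAction

variable {R Δ S Θ : Type*} [NonUnitalRing R] [Group Δ] [NonUnitalRing S] [Group Θ]
  {conjR : R → R} {actD : Δ → R → Δ} {phD : R → Δ} {piD rhoD : Δ → R}
  {conjS : S → S} {actT : Θ → S → Θ} {phT : S → Θ} {piT rhoT : Θ → S}
  {ars : R → S → S} {asr : S → R → S} {atr : Θ → R → Θ} {ads : Δ → S → Θ}
  (hR : IsOddFormRing (· + · : R → R → R) (· * ·) (- ·) 0 conjR
    (· * ·) (·⁻¹) 1 actD phD piD rhoD)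
  (hS : IsOddFormRing (· + · : S → S → S) (· * ·) (- ·) 0 conjS
    (· * ·) (·⁻¹) 1 actT phT piT rhoT)
  (h : IsOddFormAction (· + · : R → R → R) (· * ·) (- ·) 0 conjR
    (· * ·) (·⁻¹) 1 actD phD piD rhoD (· + · : S → S → S) (· * ·) (- ·) 0 conjS
    (· * ·) (·⁻¹) 1 actT phT piT rhoT ars asr atr ads)

section Action

include h

theorem rs_zero (a : R) : ars a 0 = 0 := by
  simpa using h.rs_add a 0 0

theorem zero_rs (b : S) : ars 0 b = 0 := by
  simpa using h.add_rs 0 0 b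

theorem sr_zero (b : S) : asr b 0 = 0 := by
  simpa using h.sr_add b 0 0

theorem zero_sr (a : R) : asr 0 a = 0 := by
  simpa using h.add_sr 0 0 a

theorem rs_neg (a : R) (b : S) : ars a (-b) = -ars a b := by
  rw [eq_neg_iff_add_eq_zero, ← h.rs_add, neg_add_cancel, h.rs_zero]

theorem neg_rs (a : R) (b : S) : ars (-a) b = -ars a b := by
  rw [eq_neg_iff_add_eq_zero, ← h.add_rs, neg_add_cancel, h.zero_rs]

theorem sr_neg (b : S) (a : R) : asr b (-a) = -asr b a := by
  rw [eq_neg_iff_add_eq_zero, ← h.sr_add, neg_add_cancel, h.sr_zero]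

theorem neg_sr (b : S) (a : R) : asr (-b) a = -asr b a := by
  rw [eq_neg_iff_add_eq_zero, ← h.add_sr, neg_add_cancel, h.zero_sr]

theorem one_ds (b : S) : ads 1 b = 1 := by
  simpa using h.ds_dmul 1 1 b

include hS

theorem tr_zero (v : Θ) : atr v 0 = 1 := by
  simpa [h.sr_zero, hS.ph_zero] using h.tr_add v 0 0

include hR in
theorem conj_sr (b : S) (a : R) : conjS (asr b a) = ars (conjR a) (conjS b) := by
  rw [h.rs_conj, hS.conj_conj, hR.conj_conj]

theorem conj_rs (a : R) (b : S) : conjS (ars a b) = asr (conjS b) (conjR a) := by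
  rw [h.rs_conj, hS.conj_conj]

end Action

include hR hS h

/-- The semi-direct product of odd form rings is an odd form ring. -/
theorem isOddFormRing_semidirectProduct :
    IsOddFormRing (sdAdd (· + ·) (· + ·)) (sdMul (· + ·) (· * ·) (· * ·) ars asr)
      (sdNeg (- ·) (- ·)) ((0, 0) : S × R) (sdConj conjS conjR)
      (sdDMul (· * ·) phT (- ·) ars conjR piD piT (· * ·))
      (sdDInv (· * ·) (·⁻¹) phT ars conjR piD piT (·⁻¹))
      ((1, 1) : Θ × Δ)
      (sdAct (· * ·) actT atr ads phT (· + ·) (· * ·) ars conjR rhoT (· * ·) rhoD actD)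
      (sdPh phT phD) (sdPi piT piD)
      (sdRho (· + ·) rhoT (- ·) asr conjS piT piD rhoD) := by
  constructor
  all_goals simp only [sdAdd, sdMul, sdNeg, sdConj, sdDMul, sdDInv, sdAct, sdPh, sdPi, sdRho,
    Prod.forall, Prod.mk.injEq]
  all_goals intros
  case' ph_symm => rename_i hab
  all_goals try apply And.intro
  all_goals try simp only [hR.conj_add, hR.conj_mul, hR.conj_conj, hR.conj_neg, hR.conj_zero,
    hR.conj_rho, hR.act_dmul, hR.act_act, hR.pi_dmul, hR.pi_act, hR.pi_inv,
    hR.pi_one, hR.ph_add, hR.ph_act,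
    hR.rho_dmul, hR.rho_act, hR.pi_ph, hR.rho_ph, hR.act_add,
    hS.conj_add, hS.conj_mul, hS.conj_conj, hS.conj_neg, hS.conj_zero,
    hS.conj_rho, hS.act_dmul, hS.act_act, hS.act_add, hS.pi_dmul, hS.pi_act, hS.pi_inv,
    hS.pi_one, hS.ph_act, hS.ph_mul_ph, hS.ph_mul_ph_mul, ← hS.ph_neg, hS.ph_zero,
    hS.rho_dmul, hS.rho_act, hS.pi_ph, hS.rho_ph,
    h.conj_sr hR hS, h.conj_rs hS, h.rs_zero, h.zero_rs, h.sr_zero,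
    h.rs_neg, h.neg_rs, h.sr_neg, h.neg_sr,
    h.add_rs, h.rs_add, h.add_sr, h.sr_add, h.mulR_rs, h.rs_mulS, h.rs_sr,
    h.sr_mulS, h.mulS_sr, h.sr_mulR, h.ds_dmul, h.ds_add, h.tr_dmul, h.tr_add, h.ds_actD,
    h.tr_ads, h.actT_ads, h.actT_atr, h.tr_actT, h.atr_atr, h.ph_ds, h.ph_tr, h.pi_ds, h.pi_tr,
    h.rho_ds, h.rho_tr, mul_assoc, mul_add, add_mul, mul_neg, neg_mul, neg_neg, neg_zero,
    mul_zero, zero_mul, neg_add, sub_eq_add_neg, mul_one, one_mul,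
    inv_mul_cancel, mul_inv_cancel, add_zero, zero_add]
  all_goals try abel1
  case ph_symm.left => exact hS.ph_symm _ hab.1
  case ph_symm.right => exact hR.ph_symm _ hab.2
  case comm_ph.right => rw [← hR.comm_ph]; simp only [mul_assoc]
  case dmul_assoc.left =>
    rename_i v₁ u₁ v₂ u₂ v₃ u₃
    simp only [hS.ph_mul_mul _ v₂, hS.ph_mul_ph_mul, add_assoc]
  case dmul_inv.left =>
    simp only [add_neg_cancel, hS.ph_zero, one_mul, mul_inv_cancel]
  case inv_dmul.left =>
    rename_i v u
    simp only [hS.ph_mul _ v, hS.ph_mul_ph,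
      inv_mul_cancel_left, neg_add_cancel, hS.ph_zero]
  case comm_ph.left =>
    rename_i v u v' u'
    simp only [hS.ph_mul_mul _ v⁻¹, hS.ph_mul _ v'⁻¹, hS.ph_mul_mul _ v'⁻¹,
      hS.ph_mul_mul _ v', hS.ph_mul_ph]
    rw [← mul_assoc, ← mul_assoc, ← mul_assoc, hS.comm_ph, hS.ph_mul_ph]
    apply hS.ph_eq_of_sub_eq (ars (conjR (piD u')) (piT v))
    simp only [h.conj_rs hS, hR.conj_conj]
    abel1
  case ph_act.left =>
    rename_i b a b' a'
    apply hS.ph_eq_of_sub_eq (-ars (conjR a) (conjS b' * b) - ars (conjR a) (ars (conjR a') b))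
    simp only [h.conj_rs hS, hR.conj_conj,
      hS.conj_add, hS.conj_mul, hS.conj_conj, hS.conj_neg,
      h.mulS_sr, h.sr_mulR, sub_eq_add_neg]
    abel1
  case act_dmul.left =>
    rename_i v u v' u' b a
    simp only [hS.mul_mul_eq_mul_mul_ph (actT v' b) (atr v a),
      hS.mul_mul_eq_mul_mul_ph (actT v' b) (ads u b),
      hS.mul_mul_eq_mul_mul_ph (atr v' a) (ads u b),
      hS.ph_mul_mul _ (atr _ _), hS.ph_mul_mul _ (ads _ _), hS.ph_mul_mul _ (actT _ _),
      hS.ph_mul_ph]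
    iterate 6 apply congrArg
    apply hS.ph_eq_of_sub_eq (-(conjS b * ars (conjR (piD u)) (piT v' * b)) -
      ars (conjR a) (conjS (piT v) * (piT v' * b)))
    simp only [hS.pi_act, h.pi_ds, h.pi_tr, h.conj_sr hR hS, h.conj_rs hS, hR.conj_conj,
      hS.conj_add, hS.conj_mul, hS.conj_conj, hS.conj_neg,
      h.rs_mulS, h.sr_mulS, h.mulS_sr,
      mul_assoc, sub_eq_add_neg]
    abel1
  case act_act.left =>
    rename_i v u b a b' a'
    simp only [hS.mul_mul_eq_mul_mul_ph (ads u (b * b')) (actT v (asr b a')),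
      hS.mul_mul_eq_mul_mul_ph (ads u (b * b')) (atr v (a * a')),
      hS.mul_mul_eq_mul_mul_ph (ads u (asr b a')) (ads u (ars a b')),
      hS.ph_mul_mul _ (atr _ _), hS.ph_mul_mul _ (ads _ _), hS.ph_mul_mul _ (actT _ _),
      hS.ph_mul_ph]
    iterate 7 apply congrArg
    apply hS.ph_eq_of_sub_eq (-ars (conjR a') (conjS b * (conjS (piT v) * ars (piD u) (b * b'))) -
      ars (conjR a') (ars (conjR a) (conjS (piT v) * ars (piD u) (b * b'))))
    simp only [hS.pi_act, h.pi_ds, h.pi_tr, h.conj_sr hR hS, h.conj_rs hS, hR.conj_conj,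
      hS.conj_add, hS.conj_mul, hS.conj_conj, hS.conj_neg,
      h.rs_mulS, h.rs_sr, h.sr_mulS, h.mulS_sr, h.sr_mulR,
      mul_assoc, sub_eq_add_neg]
    abel1
  case act_add.left =>
    rename_i v u b a b' a'
    simp only [hS.mul_mul_eq_mul_mul_ph (actT v b') (atr v a),
      hS.mul_mul_eq_mul_mul_ph (actT v b') (ads u b),
      hS.mul_mul_eq_mul_mul_ph (atr v a') (ads u b),
      hS.ph_mul_mul _ (atr _ _), hS.ph_mul_mul _ (ads _ _), hS.ph_mul_mul _ (actT _ _),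
      hS.ph_mul_ph]
    iterate 6 apply congrArg
    apply hS.ph_eq_of_sub_eq (ars (conjR a) (rhoT v * b') +
      ars (conjR a) (ars (conjR (piD u)) (piT v * b')) +
      ars (conjR a) (ars (conjR (piD u)) (asr (piT v) a')) +
      (ars (conjR a) (ars (rhoD u) b') + ars (conjR a) (ars (conjR (piD u)) (ars (piD u) b'))))
    simp only [hS.pi_act, h.pi_ds, h.pi_tr, h.conj_sr hR hS, h.conj_rs hS, hR.conj_conj, hR.conj_rho,
      hS.conj_add, hS.conj_mul, hS.conj_rho,
      h.sr_neg, h.neg_sr, h.add_sr, h.sr_add,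
      h.rs_mulS, h.rs_sr, h.mulS_sr, h.sr_mulR,
      mul_assoc, mul_add, mul_neg, sub_eq_add_neg]
    abel1

end IsOddFormAction

/-- If an odd form ring `(R, Δ)` acts on an odd form ring `(S, Θ)`, then the
semi-direct product `(S ⋊ R, Θ ⋊ Δ)` with the operations listed above is again
an odd form ring, and `(S, Θ) → (S ⋊ R, Θ ⋊ Δ) → (R, Δ)` is a short exact
sequence of odd form rings: the inclusions `b ↦ (b, 0)`, `v ↦ (v, 0̇)` are
injective morphisms, the projections onto the second factors are surjective
morphisms, and the kernel of the projection equals the image of the inclusion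
on both levels. -/
theorem semidirect_product_oddFormRing {R Δ S Θ : Type*}
    (addR : R → R → R) (mulR : R → R → R) (negR : R → R) (zeroR : R) (conjR : R → R)
    (mulD : Δ → Δ → Δ) (invD : Δ → Δ) (oneD : Δ)
    (actD : Δ → R → Δ) (phD : R → Δ) (piD rhoD : Δ → R)
    (addS : S → S → S) (mulS : S → S → S) (negS : S → S) (zeroS : S) (conjS : S → S)
    (mulT : Θ → Θ → Θ) (invT : Θ → Θ) (oneT : Θ)
    (actT : Θ → S → Θ) (phT : S → Θ) (piT rhoT : Θ → S)
    (ars : R → S → S) (asr : S → R → S) (atr : Θ → R → Θ) (ads : Δ → S → Θ)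
    (hR : IsOddFormRing addR mulR negR zeroR conjR mulD invD oneD actD phD piD rhoD)
    (hS : IsOddFormRing addS mulS negS zeroS conjS mulT invT oneT actT phT piT rhoT)
    (hact : IsOddFormAction addR mulR negR zeroR conjR mulD invD oneD actD phD piD rhoD
      addS mulS negS zeroS conjS mulT invT oneT actT phT piT rhoT ars asr atr ads) :
    IsOddFormRing (sdAdd addS addR) (sdMul addS mulS mulR ars asr)
      (sdNeg negS negR) ((zeroS, zeroR) : S × R) (sdConj conjS conjR)
      (sdDMul mulT phT negS ars conjR piD piT mulD)
      (sdDInv mulT invT phT ars conjR piD piT invD)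
      ((oneT, oneD) : Θ × Δ)
      (sdAct mulT actT atr ads phT addS mulS ars conjR rhoT mulR rhoD actD)
      (sdPh phT phD) (sdPi piT piD)
      (sdRho addS rhoT negS asr conjS piT piD rhoD) ∧
    Function.Injective (fun b : S => ((b, zeroR) : S × R)) ∧
    Function.Injective (fun v : Θ => ((v, oneD) : Θ × Δ)) ∧
    Function.Surjective (Prod.snd : S × R → R) ∧
    Function.Surjective (Prod.snd : Θ × Δ → Δ) ∧
    (∀ b b' : S, sdAdd addS addR (b, zeroR) (b', zeroR) = (addS b b', zeroR)) ∧
    (∀ b b' : S, sdMul addS mulS mulR ars asr (b, zeroR) (b', zeroR) = (mulS b b', zeroR)) ∧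
    (∀ b : S, sdConj conjS conjR (b, zeroR) = (conjS b, zeroR)) ∧
    (∀ v v' : Θ, sdDMul mulT phT negS ars conjR piD piT mulD (v, oneD) (v', oneD) =
      (mulT v v', oneD)) ∧
    (∀ (v : Θ) (b : S), sdAct mulT actT atr ads phT addS mulS ars conjR rhoT mulR rhoD actD
      (v, oneD) (b, zeroR) = (actT v b, oneD)) ∧
    (∀ b : S, sdPh phT phD (b, zeroR) = (phT b, oneD)) ∧
    (∀ v : Θ, sdPi piT piD (v, oneD) = (piT v, zeroR)) ∧
    (∀ v : Θ, sdRho addS rhoT negS asr conjS piT piD rhoD (v, oneD) = (rhoT v, zeroR)) ∧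
    (∀ p : S × R, p.2 = zeroR ↔ ∃ b : S, p = (b, zeroR)) ∧
    (∀ x : Θ × Δ, x.2 = oneD ↔ ∃ v : Θ, x = (v, oneD)) := by
  let _ := hR.toNonUnitalRing
  let _ := hS.toNonUnitalRing
  let _ := hR.toGroup
  let _ := hS.toGroup
  refine ⟨IsOddFormAction.isOddFormRing_semidirectProduct (conjR := conjR) (conjS := conjS)
      (actD := actD) (actT := actT) hR hS hact, Prod.mk_left_injective _,
    Prod.mk_left_injective _, fun a => ⟨(zeroS, a), rfl⟩, fun u => ⟨(oneT, u), rfl⟩,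
    fun b b' => ?_, fun b b' => ?_, fun b => ?_, fun v v' => ?_, fun v b => ?_, fun b => ?_,
    fun v => ?_, fun v => ?_, fun p => ?_, fun x => ?_⟩
  · exact Prod.ext rfl (hR.add_zero _)
  · exact Prod.ext (by
      change b * b' + ars 0 b' + asr b 0 = b * b'
      rw [hact.zero_rs, hact.sr_zero, add_zero, add_zero]) (zero_mul (0 : R))
  · exact Prod.ext rfl (IsOddFormRing.conj_zero hR)
  · exact Prod.ext (by
      change v * phT (-ars (conjR (piD 1)) (piT v')) * v' = v * v'
      rw [IsOddFormRing.pi_one hR, IsOddFormRing.conj_zero hR, hact.zero_rs, neg_zero,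
        IsOddFormRing.ph_zero hS, mul_one]) (hR.dmul_one _)
  · exact Prod.ext (by
      change actT v b * atr v 0 * ads 1 b *
        phT (ars (conjR 0) (rhoT v) * b + ars (conjR 0 * rhoD 1) b) = actT v b
      rw [hact.tr_zero hS, hact.one_ds, IsOddFormRing.conj_zero hR, zero_mul, hact.zero_rs,
        hact.zero_rs, zero_mul, add_zero, IsOddFormRing.ph_zero hS, mul_one, mul_one, mul_one])
      (IsOddFormRing.act_zero hR _)
  · exact Prod.ext rfl (IsOddFormRing.ph_zero hR)
  · exact Prod.ext rfl (IsOddFormRing.pi_one hR)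
  · exact Prod.ext (by
      change rhoT v + -asr (conjS (piT v)) (piD 1) = rhoT v
      rw [IsOddFormRing.pi_one hR, hact.sr_zero, neg_zero, add_zero]) (IsOddFormRing.rho_one hR)
  · exact ⟨fun h => ⟨p.1, Prod.ext rfl h⟩, fun ⟨_, h⟩ => congrArg Prod.snd h⟩
  · exact ⟨fun h => ⟨x.1, Prod.ext rfl h⟩, fun ⟨_, h⟩ => congrArg Prod.snd h⟩
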